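/- Let n ≥ 3 and let F be a triangle-intersecting family of subgraphs of the complete graph K_n. Then |F| ≤ (1/8)·2^(C(n,2)), where C(n,2) = n(n−1)/2. -/

import Mathlib

/-- The edge set of the complete graph `K_n` on vertex set `Fin n`:
all non-diagonal unordered pairs. -/
def edgeFinset (n : ℕ) : Finset (Sym2 (Fin n)) :=
  Finset.univ.filter (fun e => ¬ e.IsDiag)

/-- `T` is a triangle: the three edges on three distinct vertices. -/
def IsTriangle {n : ℕ} (T : Finset (Sym2 (Fin n))) : Prop :=
  ∃ a b c : Fin n, a ≠ b ∧ a ≠ c ∧ b ≠ c ∧ T = {s(a, b), s(a, c), s(b, c)}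

/-- A family of graphs is triangle-intersecting if the intersection of any
two members contains a triangle. -/
def TriangleIntersecting {n : ℕ} (F : Finset (Finset (Sym2 (Fin n)))) : Prop :=
  ∀ G ∈ F, ∀ H ∈ F, ∃ T : Finset (Sym2 (Fin n)), IsTriangle T ∧ T ⊆ G ∩ H

open Finset

/-- The function of the number of cut edges whose signed average over all cuts gives the
eigenvalues, scaled by `28`. -/
def cutWeight : ℕ → ℤ
  | 0 => 28
  | 1 => -20
  | 2 => -4
  | 3 => 3
  | _ => 0

lemma cutWeight_eq (k : ℕ) :
    cutWeight k = 28 * (if k = 0 then 1 else 0) - 20 * (if k = 1 then 1 else 0)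
      - 4 * (if k = 2 then 1 else 0) + 3 * (if k = 3 then 1 else 0) := by
  rcases k with _ | _ | _ | _ | k <;> simp [cutWeight]

section Code

lemma two_mul_card_eq_one {M : Type*} [AddCommGroup M] [Fintype M] (f : M →+ ZMod 2)
    {m : M} (hm : f m = 1) : 2 * #{c | f c = 1} = Fintype.card M := by
  have h : #{c | f c = 1} = #{c | ¬ f c = 1} := by
    refine Finset.card_bij' (fun c _ => c + m) (fun c _ => c - m) ?_ ?_ ?_ ?_
    · intro c hc
      simp only [mem_filter, mem_univ, true_and] at hc
      simp only [mem_filter, mem_univ, true_and, map_add, hc, hm]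
      decide
    · intro c hc
      simp only [mem_filter, mem_univ, true_and] at hc
      simp only [mem_filter, mem_univ, true_and, map_sub, hm]
      revert hc
      generalize f c = y
      revert y
      decide
    · simp
    · simp
  have h' := card_filter_add_card_filter_not (s := (univ : Finset M)) (fun c => f c = 1)
  rw [card_univ] at h'
  omega

variable {ι : Type*} {C : Submodule (ZMod 2) (ι → ZMod 2)} [Fintype C]

lemma two_mul_card_coord (h0 : ∀ i, ∃ c ∈ C, c i = 1) (i : ι) :
    2 * #{c : C | (c : ι → ZMod 2) i = 1} = Fintype.card C := by
  obtain ⟨m, hm, hi⟩ := h0 i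
  exact two_mul_card_eq_one
    ((LinearMap.proj (R := ZMod 2) (φ := fun _ : ι => ZMod 2) i ∘ₗ C.subtype).toAddMonoidHom)
    (m := ⟨m, hm⟩) hi

lemma four_mul_card_coord_coord (h0 : ∀ i, ∃ c ∈ C, c i = 1)
    (h1 : ∀ i j, i ≠ j → ∃ c ∈ C, c i ≠ c j) {i j : ι} (hij : i ≠ j) :
    4 * #{c : C | (c : ι → ZMod 2) i = 1 ∧ (c : ι → ZMod 2) j = 1} = Fintype.card C := by
  obtain ⟨m, hm, hne⟩ := h1 i j hij
  have hsum : m i + m j = 1 := by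
    revert hne
    generalize m i = x
    generalize m j = y
    revert x y
    decide
  have h := two_mul_card_eq_one
    (((LinearMap.proj (R := ZMod 2) (φ := fun _ : ι => ZMod 2) i
      + LinearMap.proj (R := ZMod 2) (φ := fun _ : ι => ZMod 2) j) ∘ₗ C.subtype).toAddMonoidHom)
    (m := ⟨m, hm⟩) hsum
  have hi := two_mul_card_coord h0 i
  have hj := two_mul_card_coord h0 j
  have key : #{c : C | (c : ι → ZMod 2) i = 1} + #{c : C | (c : ι → ZMod 2) j = 1}
      = #{c : C | (c : ι → ZMod 2) i + (c : ι → ZMod 2) j = 1}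
        + 2 * #{c : C | (c : ι → ZMod 2) i = 1 ∧ (c : ι → ZMod 2) j = 1} := by
    simp only [Finset.card_filter, Finset.mul_sum, ← Finset.sum_add_distrib]
    refine Finset.sum_congr rfl fun c _ => ?_
    generalize (c : ι → ZMod 2) i = x
    generalize (c : ι → ZMod 2) j = y
    revert x y
    decide
  have h' : 2 * #{c : C | (c : ι → ZMod 2) i + (c : ι → ZMod 2) j = 1} = Fintype.card C := h
  omega

lemma card_code_eq_pow : ∃ r, Fintype.card C = 2 ^ r :=
  ⟨Module.finrank (ZMod 2) C, by
    rw [Module.card_eq_pow_finrank (K := ZMod 2) (V := C), ZMod.card]⟩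

variable [Fintype ι]

lemma hammingNorm_cast_zmod_two (c : ι → ZMod 2) : (hammingNorm c : ZMod 2) = ∑ i, c i := by
  have h : ∀ y : ZMod 2, (if y ≠ 0 then 1 else 0 : ZMod 2) = y := by decide
  simp only [hammingNorm, ← Finset.sum_boole, h]

lemma hammingNorm_eq_sum (c : ι → ZMod 2) :
    hammingNorm c = ∑ i, if c i = 1 then 1 else 0 := by
  have h : ∀ y : ZMod 2, y ≠ 0 ↔ y = 1 := by decide
  simp [hammingNorm, h]

variable (C)

/-- The number of codewords of weight `k`. -/
noncomputable def weightCount (k : ℕ) : ℕ := #{c : C | hammingNorm (c : ι → ZMod 2) = k}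

lemma sum_comp_hammingNorm {A : Type*} [CommSemiring A] (f : ℕ → A) :
    ∑ c : C, f (hammingNorm (c : ι → ZMod 2))
      = ∑ k ∈ range (Fintype.card ι + 1), (weightCount C k : A) * f k := by
  rw [← Finset.sum_fiberwise_of_maps_to (s := univ) (t := range (Fintype.card ι + 1))
    (g := fun c : C => hammingNorm (c : ι → ZMod 2))]
  · refine Finset.sum_congr rfl fun k _ => ?_
    rw [Finset.sum_congr rfl (g := fun _ => f k)]
    · simp [weightCount]
    · intro c hc
      rw [(Finset.mem_filter.1 hc).2]
  · intro c _
    have := hammingNorm_le_card_fintype (x := (c : ι → ZMod 2))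
    simp only [mem_range]
    omega

lemma sum_cutWeight_code :
    ∑ c : C, cutWeight (hammingNorm (c : ι → ZMod 2))
      = 28 * weightCount C 0 - 20 * weightCount C 1 - 4 * weightCount C 2
        + 3 * weightCount C 3 := by
  simp only [cutWeight_eq, Finset.sum_add_distrib, Finset.sum_sub_distrib, ← Finset.mul_sum,
    Finset.sum_boole, weightCount]

lemma weightCount_zero : weightCount C 0 = 1 := by
  classical
  rw [weightCount, Finset.card_eq_one]
  refine ⟨0, ?_⟩
  ext c
  simp [hammingNorm_eq_zero]

lemma sum_weightCount_le (K : Finset ℕ) :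
    ∑ k ∈ K, weightCount C k ≤ Fintype.card C := by
  have := Finset.card_eq_sum_card_fiberwise (s := univ.filter
    (fun c : C => hammingNorm (c : ι → ZMod 2) ∈ K)) (t := K)
    (f := fun c : C => hammingNorm (c : ι → ZMod 2)) (fun c hc => by simpa using hc)
  calc ∑ k ∈ K, weightCount C k
      = #(univ.filter (fun c : C => hammingNorm (c : ι → ZMod 2) ∈ K)) := by
        rw [this]
        refine Finset.sum_congr rfl fun k hk => ?_
        rw [weightCount]
        congr 1
        ext c
        simp only [mem_filter, mem_univ, true_and]
        exact ⟨fun h => ⟨h ▸ hk, h⟩, fun h => h.2⟩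
    _ ≤ Fintype.card C := Finset.card_le_univ _

/-- Either all words have even weight or exactly half of them do. -/
lemma card_odd_weight :
    #{c : C | Odd (hammingNorm (c : ι → ZMod 2))} = 0 ∨
      2 * #{c : C | Odd (hammingNorm (c : ι → ZMod 2))} = Fintype.card C := by
  have h1 : ∀ c : C, Odd (hammingNorm (c : ι → ZMod 2)) ↔ ∑ i, (c : ι → ZMod 2) i = 1 := by
    intro c
    rw [← hammingNorm_cast_zmod_two, ZMod.natCast_eq_one_iff_odd]
  by_cases h : ∃ c : C, ∑ i, (c : ι → ZMod 2) i = 1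
  · right
    obtain ⟨m, hm⟩ := h
    let f : C →+ ZMod 2 :=
      { toFun := fun c => ∑ i, (c : ι → ZMod 2) i
        map_zero' := by simp
        map_add' := fun x y => by simp [Finset.sum_add_distrib] }
    simp only [h1]
    exact two_mul_card_eq_one f hm
  · left
    push Not at h
    simp [h1, h]

lemma sum_odd_weightCount :
    ∑ k ∈ range (Fintype.card ι + 1) with Odd k, weightCount C k
      = #{c : C | Odd (hammingNorm (c : ι → ZMod 2))} := by
  rw [Finset.card_filter, sum_comp_hammingNorm C (fun k => if Odd k then 1 else 0)]
  simp [Finset.sum_filter]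

variable {C}

lemma two_mul_sum_hammingNorm (h0 : ∀ i, ∃ c ∈ C, c i = 1) :
    2 * ∑ c : C, hammingNorm (c : ι → ZMod 2) = Fintype.card ι * Fintype.card C := by
  simp only [hammingNorm_eq_sum]
  rw [Finset.sum_comm, Finset.mul_sum]
  simp only [← Finset.card_filter, two_mul_card_coord h0]
  simp

lemma four_mul_sum_hammingNorm_sq (h0 : ∀ i, ∃ c ∈ C, c i = 1)
    (h1 : ∀ i j, i ≠ j → ∃ c ∈ C, c i ≠ c j) :
    4 * ∑ c : C, hammingNorm (c : ι → ZMod 2) ^ 2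
      = Fintype.card ι * (Fintype.card ι + 1) * Fintype.card C := by
  classical
  have hsq : ∀ c : C, hammingNorm (c : ι → ZMod 2) ^ 2
      = ∑ i, ∑ j, if (c : ι → ZMod 2) i = 1 ∧ (c : ι → ZMod 2) j = 1 then 1 else 0 := by
    intro c
    rw [hammingNorm_eq_sum, sq, Finset.sum_mul_sum]
    simp only [ite_and, ite_mul, one_mul, zero_mul]
  have hij : ∀ i j : ι, 4 * #{c : C | (c : ι → ZMod 2) i = 1 ∧ (c : ι → ZMod 2) j = 1}
      = Fintype.card C + if i = j then Fintype.card C else 0 := by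
    intro i j
    by_cases h : i = j
    · subst h
      have := two_mul_card_coord h0 i
      simp only [and_self, if_pos]
      omega
    · rw [four_mul_card_coord_coord h0 h1 h, if_neg h, add_zero]
  simp only [hsq]
  rw [Finset.sum_comm, Finset.mul_sum]
  have : ∀ i : ι, 4 * ∑ c : C, ∑ j,
      (if (c : ι → ZMod 2) i = 1 ∧ (c : ι → ZMod 2) j = 1 then 1 else 0)
      = (Fintype.card ι + 1) * Fintype.card C := by
    intro i
    rw [Finset.sum_comm, Finset.mul_sum]
    simp only [← Finset.card_filter, hij, Finset.sum_add_distrib]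
    simp [add_mul]
  simp only [this]
  simp [mul_assoc]

/-- The length of a binary code with distinct nonzero coordinates is less than its size. -/
lemma card_lt_card_code (h0 : ∀ i, ∃ c ∈ C, c i = 1)
    (h1 : ∀ i j, i ≠ j → ∃ c ∈ C, c i ≠ c j) : Fintype.card ι < Fintype.card C := by
  by_contra! hle
  have hpos : 0 < Fintype.card C := Fintype.card_pos
  have hs1 := two_mul_sum_hammingNorm h0
  have hs2 := four_mul_sum_hammingNorm_sq h0 h1
  have hcs := sq_sum_le_card_mul_sum_sq (s := univ.erase (0 : C))
    (f := fun c : C => hammingNorm (c : ι → ZMod 2))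
  rw [Finset.sum_erase _ (by simp), Finset.sum_erase _ (by simp),
    Finset.card_erase_of_mem (mem_univ _), card_univ] at hcs
  obtain ⟨p, hp⟩ : ∃ p, Fintype.card C = p + 1 := ⟨_, (Nat.succ_pred_eq_of_pos hpos).symm⟩
  rw [hp] at hcs hs1 hs2 hle
  simp only [Nat.add_sub_cancel] at hcs
  set N := Fintype.card ι
  have h4 : (N * (p + 1)) * (N * (p + 1)) ≤ p * (N * (N + 1) * (p + 1)) := by
    rw [← hs1, ← hs2]
    nlinarith
  have hN : 0 < N := by omega
  have h5 : N * (p + 1) ≤ p * (N + 1) := by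
    refine Nat.le_of_mul_le_mul_left (c := N * (p + 1)) ?_ (by positivity)
    linarith
  nlinarith

variable (C) in
open Classical in
lemma weightCount_one_eq : weightCount C 1 = #{i : ι | Pi.single i 1 ∈ C} := by
  rw [weightCount]
  symm
  refine Finset.card_bij (fun i hi => ⟨Pi.single i 1, (Finset.mem_filter.1 hi).2⟩) ?_ ?_ ?_
  · intro i hi
    rw [mem_filter, hammingNorm, Finset.card_eq_one]
    exact ⟨mem_univ _, i, by ext j; simp [Pi.single_apply]⟩
  · intro i _ j _ h
    have h := congrFun (congrArg Subtype.val h) i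
    by_contra hne
    simp [hne] at h
  · rintro ⟨c, hc⟩ hw
    simp only [mem_filter, mem_univ, true_and, hammingNorm] at hw
    obtain ⟨i, hi⟩ := Finset.card_eq_one.1 hw
    have hci : c = Pi.single i 1 := by
      ext j
      have hj : c j ≠ 0 ↔ j = i := by
        have := congrArg (j ∈ ·) hi
        simpa using this
      have h2 : ∀ y : ZMod 2, y ≠ 0 → y = 1 := by decide
      by_cases h : j = i
      · rw [h2 _ (hj.2 h)]
        simp [h]
      · simpa [Pi.single_apply, h] using fun h' => h (hj.1 h')
    exact ⟨i, by simpa [← hci] using hc, by simp [hci]⟩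

/-- A code contains the full cube on the coordinates carrying unit vectors; if it is no larger,
then there are no other coordinates. -/
lemma two_pow_weightCount_one_le (h0 : ∀ i, ∃ c ∈ C, c i = 1) :
    2 ^ weightCount C 1 ≤ Fintype.card C ∧
      (2 ^ weightCount C 1 = Fintype.card C → Fintype.card ι = weightCount C 1) := by
  classical
  set T : Finset ι := {i : ι | Pi.single i 1 ∈ C} with hT
  have hm : weightCount C 1 = #T := weightCount_one_eq C
  let ψ : (T → ZMod 2) → C := fun t =>
    ⟨∑ i : T, t i • Pi.single (i : ι) 1, C.sum_mem fun i _ => C.smul_mem _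
      (Finset.mem_filter.1 i.2).2⟩
  have hψ : ∀ (t : T → ZMod 2) (j : ι),
      (ψ t : ι → ZMod 2) j = ∑ i : T, if j = i then t i else 0 := by
    intro t j
    simp [ψ, Finset.sum_apply, Pi.single_apply]
  have hinj : Function.Injective ψ := by
    intro t t' h
    ext j
    have h := congrFun (congrArg Subtype.val h) j
    rw [hψ, hψ] at h
    simpa [Subtype.coe_inj] using h
  have hcard : Fintype.card (T → ZMod 2) = 2 ^ weightCount C 1 := by
    simp [hm, ZMod.card]
  refine ⟨hcard ▸ Fintype.card_le_of_injective ψ hinj, fun heq => ?_⟩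
  have hsurj := ((Fintype.bijective_iff_injective_and_card ψ).2 ⟨hinj, hcard.trans heq⟩).2
  have hTuniv : T = univ := by
    refine Finset.eq_univ_of_forall fun i => ?_
    by_contra hi
    obtain ⟨c, hc, hci⟩ := h0 i
    obtain ⟨t, ht⟩ := hsurj ⟨c, hc⟩
    have := hψ t i
    rw [ht] at this
    simp only [hci] at this
    rw [Finset.sum_eq_zero] at this
    · exact one_ne_zero this
    · rintro ⟨j, hj⟩ _
      rw [if_neg]
      rintro rfl
      exact hi hj
  rw [hm, hTuniv, card_univ]

lemma sum_cutWeight_code_even (h0 : ∀ i, ∃ c ∈ C, c i = 1) (hN : Even (Fintype.card ι)) :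
    -4 * (Fintype.card C : ℤ) ≤ ∑ c : C, cutWeight (hammingNorm (c : ι → ZMod 2)) := by
  rw [sum_cutWeight_code, weightCount_zero]
  obtain ⟨r, hr⟩ := card_code_eq_pow (C := C)
  obtain ⟨hle, heq⟩ := two_pow_weightCount_one_le h0
  have hsum := sum_weightCount_le C {0, 1, 2, 3}
  have hodd := card_odd_weight C
  have hcompl := card_filter_add_card_filter_not (s := (univ : Finset C))
    (fun c => Odd (hammingNorm (c : ι → ZMod 2)))
  rw [card_univ] at hcompl
  have hone : weightCount C 1 ≤ #{c : C | Odd (hammingNorm (c : ι → ZMod 2))} :=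
    Finset.card_le_card (Finset.monotone_filter_right _ fun c _ h => by
      have h : hammingNorm (c : ι → ZMod 2) = 1 := h
      rw [h]; exact odd_one)
  have heven : weightCount C 0 + weightCount C 2
      ≤ #{c : C | ¬ Odd (hammingNorm (c : ι → ZMod 2))} := by
    rw [weightCount, weightCount, ← Finset.card_union_of_disjoint]
    · refine Finset.card_le_card fun c hc => ?_
      simp only [mem_union, mem_filter, mem_univ, true_and] at hc ⊢
      rcases hc with h | h <;> rw [h] <;> decide
    · refine Finset.disjoint_filter.2 fun c _ h h' => by omega
  simp only [weightCount_zero] at heven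
  simp [weightCount_zero] at hsum
  set m := weightCount C 1 with hm
  by_cases hm2 : m ≤ 2
  · push_cast
    omega
  have hPodd : 2 * #{c : C | Odd (hammingNorm (c : ι → ZMod 2))} = Fintype.card C := by
    omega
  suffices h : 20 * m ≤ 2 * Fintype.card C + 32 ∨
      20 * m + 4 * weightCount C 2 ≤ 4 * Fintype.card C + 28 + 3 * weightCount C 3 by
    push_cast
    omega
  rw [hr] at hle heq
  have hmr : m ≤ r := (Nat.pow_le_pow_iff_right (by norm_num)).1 hle
  have hgrow : ∀ k, 20 * (k + 3) ≤ 4 * 2 ^ (k + 3) + 32 := by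
    intro k
    induction k with
    | zero => norm_num
    | succ k ih =>
      have : 2 ^ 3 ≤ 2 ^ (k + 3) := Nat.pow_le_pow_right (by norm_num) (by omega)
      rw [show k + 1 + 3 = (k + 3) + 1 by ring, pow_succ]
      omega
  have hgrow := hgrow (m - 3)
  rw [show m - 3 + 3 = m by omega] at hgrow
  rcases hmr.lt_or_eq with hlt | hmr
  · left
    have : 2 ^ (m + 1) ≤ 2 ^ r := Nat.pow_le_pow_right (by norm_num) hlt
    rw [pow_succ, ← hr] at this
    omega
  · have hNm : Fintype.card ι = m := heq (by rw [hmr])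
    by_cases hm4 : m = 4
    · right
      have hs1 := two_mul_sum_hammingNorm h0
      have hs0 := sum_comp_hammingNorm C (fun _ => (1 : ℕ))
      have hso := sum_odd_weightCount C
      rw [sum_comp_hammingNorm C (fun k => k)] at hs1
      rw [hNm, hm4] at hs0 hs1 hso
      rw [← hmr, hm4] at hr
      rw [← hso] at hPodd
      simp [Finset.sum_range_succ, Finset.sum_filter, weightCount_zero, ← hm, hm4,
        Nat.odd_iff] at hs0 hs1 hPodd
      omega
    · left
      rw [hNm] at hN
      have h6 : 6 ≤ m := by
        obtain ⟨k, hk⟩ := hN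
        omega
      have hgrow2 : ∀ k, 20 * (k + 6) ≤ 2 * 2 ^ (k + 6) + 32 := by
        intro k
        induction k with
        | zero => norm_num
        | succ k ih =>
          have : 2 ^ 6 ≤ 2 ^ (k + 6) := Nat.pow_le_pow_right (by norm_num) (by omega)
          rw [show k + 1 + 6 = (k + 6) + 1 by ring, pow_succ]
          omega
      have := hgrow2 (m - 6)
      rw [show m - 6 + 6 = m by omega, hmr] at this
      rw [hr, hmr]
      exact this

lemma sum_cutWeight_code_odd (h0 : ∀ i, ∃ c ∈ C, c i = 1)
    (h1 : ∀ i j, i ≠ j → ∃ c ∈ C, c i ≠ c j) (hN : Odd (Fintype.card ι)) :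
    ∑ c : C, cutWeight (hammingNorm (c : ι → ZMod 2)) ≤ 4 * (Fintype.card C : ℤ) := by
  rw [sum_cutWeight_code, weightCount_zero]
  obtain ⟨r, hr⟩ := card_code_eq_pow (C := C)
  have hodd := card_odd_weight C
  have hthree : weightCount C 3 ≤ #{c : C | Odd (hammingNorm (c : ι → ZMod 2))} :=
    Finset.card_le_card (Finset.monotone_filter_right _ fun c _ h => by
      have h : hammingNorm (c : ι → ZMod 2) = 3 := h
      rw [h]; decide)
  by_cases hr4 : 4 ≤ r
  · have : 2 ^ 4 ≤ 2 ^ r := Nat.pow_le_pow_right (by norm_num) hr4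
    rw [← hr] at this
    push_cast
    omega
  have hlt := card_lt_card_code h0 h1
  have hs1 := two_mul_sum_hammingNorm h0
  have hs2 := four_mul_sum_hammingNorm_sq h0 h1
  have hs0 := sum_comp_hammingNorm C (fun _ => (1 : ℕ))
  have hsum := sum_weightCount_le C {0, 1, 2, 3}
  rw [← sum_odd_weightCount C] at hodd
  rw [sum_comp_hammingNorm C (fun k => k)] at hs1
  rw [sum_comp_hammingNorm C (fun k => k ^ 2)] at hs2
  have hz := weightCount_zero C
  obtain ⟨q, hq⟩ := hN
  have hr3 : r ≤ 3 := by omega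
  have hq3 : q ≤ 3 := by
    have : 2 ^ r ≤ 2 ^ 3 := Nat.pow_le_pow_right (by norm_num) hr3
    omega
  rw [hq] at hlt hs0 hs1 hs2 hodd
  interval_cases r <;> interval_cases q <;>
    simp [Finset.sum_range_succ, Finset.sum_filter, hr, hz, Nat.odd_iff]
      at hlt hs0 hs1 hs2 hsum hodd ⊢ <;>
    omega

lemma neg_one_pow_mul_sum_cutWeight_code (h0 : ∀ i, ∃ c ∈ C, c i = 1)
    (h1 : ∀ i j, i ≠ j → ∃ c ∈ C, c i ≠ c j) :
    -4 * (Fintype.card C : ℤ)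
      ≤ (-1) ^ Fintype.card ι * ∑ c : C, cutWeight (hammingNorm (c : ι → ZMod 2)) := by
  rcases Nat.even_or_odd (Fintype.card ι) with hN | hN
  · rw [hN.neg_one_pow, one_mul]
    exact sum_cutWeight_code_even h0 hN
  · rw [hN.neg_one_pow]
    have := sum_cutWeight_code_odd h0 h1 hN
    linarith

end Code

section Functionals

variable {X : Type*} [AddCommGroup X] [Module (ZMod 2) X] [Fintype X]

lemma sum_comp_linearMap {Y A : Type*} [AddCommGroup Y] [Module (ZMod 2) Y] [DecidableEq Y]
    [CommSemiring A] (φ : X →ₗ[ZMod 2] Y) [Fintype (LinearMap.range φ)]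
    (h : Y → A) :
    ∑ x, h (φ x) = #{x | φ x = 0} * ∑ y : LinearMap.range φ, h y := by
  rw [← Finset.sum_fiberwise_of_maps_to (s := univ) (t := univ) (g := φ.rangeRestrict)
    (fun _ _ => mem_univ _), Finset.mul_sum]
  refine Finset.sum_congr rfl fun y _ => ?_
  rw [Finset.sum_congr rfl (g := fun _ => h y)]
  · rw [Finset.sum_const, nsmul_eq_mul]
    congr 2
    have := AddMonoidHom.card_fiber_eq_of_mem_range φ (x := (y : Y)) (y := (0 : Y))
      y.2 ⟨0, map_zero φ⟩
    rw [← this]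
    congr 1
    ext x
    simp [Subtype.ext_iff]
  · intro x hx
    have := (Finset.mem_filter.1 hx).2
    rw [← this]
    rfl

variable {E : Type*} [DecidableEq E]

/-- The eigenvalue bound: distinct nonzero binary functionals have signed mean cut weight at least
`-4`. -/
lemma neg_one_pow_mul_sum_cutWeight (b : E → X →ₗ[ZMod 2] ZMod 2) (R : Finset E)
    (hb0 : ∀ e ∈ R, b e ≠ 0) (hb1 : Set.InjOn b R) :
    -4 * (Fintype.card X : ℤ)
      ≤ (-1) ^ #R * ∑ x, cutWeight #{e ∈ R | b e x = 1} := by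
  classical
  let φ : X →ₗ[ZMod 2] (R → ZMod 2) := LinearMap.pi fun e => b e
  have hone : ∀ y : ZMod 2, y ≠ 0 ↔ y = 1 := by decide
  have hw : ∀ x, #{e ∈ R | b e x = 1} = hammingNorm (φ x) := by
    intro x
    simp only [hammingNorm, φ, LinearMap.pi_apply, hone]
    rw [Finset.card_filter, Finset.card_filter, ← Finset.sum_coe_sort]
  have hcode := neg_one_pow_mul_sum_cutWeight_code (C := LinearMap.range φ) (by
      rintro ⟨e, he⟩
      obtain ⟨x, hx⟩ : ∃ x, b e x ≠ 0 := by
        by_contra! h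
        exact hb0 e he (LinearMap.ext h)
      exact ⟨φ x, ⟨x, rfl⟩, (hone _).1 hx⟩) (by
      rintro ⟨e, he⟩ ⟨e', he'⟩ hne
      obtain ⟨x, hx⟩ : ∃ x, b e x ≠ b e' x := by
        by_contra! h
        exact hne (Subtype.ext (hb1 he he' (LinearMap.ext h)))
      exact ⟨φ x, ⟨x, rfl⟩, hx⟩)
  have hcard : (Fintype.card X : ℤ) = #{x | φ x = 0} * Fintype.card (LinearMap.range φ) := by
    have := sum_comp_linearMap φ (fun _ => (1 : ℤ))
    simpa using this
  simp only [hw]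
  rw [sum_comp_linearMap φ (fun y => cutWeight (hammingNorm y)), hcard]
  rw [Fintype.card_coe] at hcode
  have := mul_le_mul_of_nonneg_left hcode (Nat.cast_nonneg (α := ℤ) #{x | φ x = 0})
  calc _ = _ := by ring
    _ ≤ _ := this
    _ = _ := by ring

end Functionals

section Fourier

variable {E : Type*} [DecidableEq E]

/-- The value at `A` of the Walsh character indexed by `R`. -/
def walsh (R A : Finset E) : ℤ := ∏ e ∈ R, if e ∈ A then -1 else 1

/-- The Walsh coefficient at `R` of the indicator of `F`. -/
def walshCoeff (F : Finset (Finset E)) (R : Finset E) : ℤ := ∑ A ∈ F, walsh R A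

lemma walshCoeff_sq (F : Finset (Finset E)) (R : Finset E) :
    walshCoeff F R ^ 2 = ∑ A ∈ F, ∑ B ∈ F, walsh R A * walsh R B := by
  rw [walshCoeff, sq, Finset.sum_mul_sum]

lemma sum_walsh_mul_walsh {S A B : Finset E} (hA : A ⊆ S) (hB : B ⊆ S) :
    ∑ R ∈ S.powerset, walsh R A * walsh R B = if A = B then 2 ^ #S else 0 := by
  simp only [walsh, ← Finset.prod_mul_distrib]
  rw [← Finset.prod_one_add]
  split_ifs with h
  · subst h
    rw [Finset.prod_congr rfl (g := fun _ => 2), Finset.prod_const]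
    intro e _
    split_ifs <;> norm_num
  · obtain ⟨e, he⟩ : ∃ e, ¬ (e ∈ A ↔ e ∈ B) := by
      by_contra! h'
      exact h (Finset.ext h')
    have heS : e ∈ S := by
      by_cases h' : e ∈ A
      · exact hA h'
      · exact hB (by tauto)
    refine Finset.prod_eq_zero heS ?_
    by_cases h' : e ∈ A <;> by_cases h'' : e ∈ B <;> simp_all

/-- Parseval's identity for the indicator of `F`. -/
lemma sum_walshCoeff_sq {S : Finset E} {F : Finset (Finset E)} (hF : F ⊆ S.powerset) :
    ∑ R ∈ S.powerset, walshCoeff F R ^ 2 = 2 ^ #S * #F := by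
  simp only [walshCoeff_sq]
  rw [Finset.sum_comm]
  have : ∀ A ∈ F, ∑ R ∈ S.powerset, ∑ B ∈ F, walsh R A * walsh R B = 2 ^ #S := by
    intro A hA
    rw [Finset.sum_comm]
    rw [Finset.sum_congr rfl fun B hB => sum_walsh_mul_walsh (mem_powerset.1 (hF hA))
      (mem_powerset.1 (hF hB))]
    simp [hA]
  rw [Finset.sum_congr rfl this]
  simp [mul_comm]

/-- If `A` and `B` share an element not satisfying `h`, then toggling it in `R` cancels the terms of this
sum in pairs. -/
lemma sum_sign_walsh_eq_zero {S A B : Finset E} (h : E → Prop) [DecidablePred h]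
    (g : ℕ → ℤ) {e : E} (heS : e ∈ S) (heA : e ∈ A) (heB : e ∈ B) (he : ¬ h e) :
    ∑ R ∈ S.powerset, (-1) ^ #R * g #(R.filter h) * (walsh R A * walsh R B) = 0 := by
  rw [← Finset.insert_erase heS, Finset.sum_powerset_insert (Finset.notMem_erase _ _),
    ← Finset.sum_add_distrib]
  refine Finset.sum_eq_zero fun R hR => ?_
  have heR : e ∉ R := fun h => Finset.notMem_erase e S (mem_powerset.1 hR h)
  simp only [walsh, Finset.prod_insert heR, Finset.card_insert_of_notMem heR,
    Finset.filter_insert, if_neg he, if_pos heA, if_pos heB]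
  ring

/-- A family of sets, any two of which share an element outside every member of the cut space
spanned by distinct nonzero binary functionals, has density at most `1/8`. -/
theorem eight_mul_card_le {X : Type*} [AddCommGroup X] [Module (ZMod 2) X] [Fintype X]
    (b : E → X →ₗ[ZMod 2] ZMod 2) (S : Finset E) (hb0 : ∀ e ∈ S, b e ≠ 0)
    (hb1 : Set.InjOn b S) {F : Finset (Finset E)} (hF : F ⊆ S.powerset)
    (hInt : ∀ A ∈ F, ∀ B ∈ F, ∀ x, ∃ e ∈ A ∩ B, b e x ≠ 1) :
    8 * #F ≤ 2 ^ #S := by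
  set L : Finset E → ℤ := fun R => (-1) ^ #R * ∑ x, cutWeight #{e ∈ R | b e x = 1} with hL
  have hzero : ∑ R ∈ S.powerset, L R * walshCoeff F R ^ 2 = 0 := by
    simp only [hL, walshCoeff_sq, Finset.mul_sum, Finset.sum_mul]
    rw [Finset.sum_comm]
    refine Finset.sum_eq_zero fun A hA => ?_
    rw [Finset.sum_comm]
    refine Finset.sum_eq_zero fun B hB => ?_
    rw [Finset.sum_comm]
    refine Finset.sum_eq_zero fun x _ => ?_
    obtain ⟨e, he, hx⟩ := hInt A hA B hB x
    rw [mem_inter] at he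
    exact sum_sign_walsh_eq_zero (fun e => b e x = 1) cutWeight (mem_powerset.1 (hF hA) he.1)
      he.1 he.2 hx
  have hL0 : L ∅ = 28 * Fintype.card X := by
    simp [hL, cutWeight, mul_comm]
  have hLR : ∀ R ∈ S.powerset, -4 * (Fintype.card X : ℤ) ≤ L R := fun R hR =>
    neg_one_pow_mul_sum_cutWeight b R (fun e he => hb0 e (mem_powerset.1 hR he))
      (hb1.mono (by exact_mod_cast mem_powerset.1 hR))
  have hc0 : walshCoeff F ∅ = #F := by simp [walshCoeff, walsh]
  have hX : (0 : ℤ) < Fintype.card X := by exact_mod_cast Fintype.card_pos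
  have hsingle : (L ∅ + 4 * Fintype.card X) * walshCoeff F ∅ ^ 2
      ≤ ∑ R ∈ S.powerset, (L R + 4 * Fintype.card X) * walshCoeff F R ^ 2 :=
    Finset.single_le_sum (f := fun R => (L R + 4 * Fintype.card X) * walshCoeff F R ^ 2)
      (fun R hR => mul_nonneg (by linarith [hLR R hR]) (sq_nonneg _))
      (empty_mem_powerset S)
  simp only [add_mul, Finset.sum_add_distrib] at hsingle
  rw [hzero, ← Finset.mul_sum, sum_walshCoeff_sq hF, hL0, hc0] at hsingle
  rcases Nat.eq_zero_or_pos #F with h | h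
  · simp [h]
  have hpos : (0 : ℤ) < 4 * Fintype.card X * #F := by positivity
  have hle : (4 * Fintype.card X * #F : ℤ) * (8 * #F) ≤ 4 * Fintype.card X * #F * 2 ^ #S := by
    linarith
  exact_mod_cast le_of_mul_le_mul_left hle hpos

end Fourier

section CutFunctional

variable {V : Type*}

/-- The functional sending a two-colouring to whether it cuts the edge `e`. -/
def cutFunctional : Sym2 V → (V → ZMod 2) →ₗ[ZMod 2] ZMod 2 :=
  Sym2.lift ⟨fun i j => LinearMap.proj i + LinearMap.proj j, fun _ _ => add_comm _ _⟩

@[simp]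
lemma cutFunctional_mk (i j : V) (x : V → ZMod 2) : cutFunctional s(i, j) x = x i + x j := rfl

lemma cutFunctional_single [DecidableEq V] {e : Sym2 V} (he : ¬ e.IsDiag) (v : V) :
    cutFunctional e (Pi.single v 1) = 1 ↔ v ∈ e := by
  induction e with
  | h i j =>
    rw [Sym2.mk_isDiag_iff] at he
    rw [cutFunctional_mk, Sym2.mem_iff]
    by_cases hi : v = i
    · subst hi
      simp [Ne.symm he]
    · by_cases hj : v = j
      · subst hj
        simp [he]
      · simp [hi, hj, Ne.symm hi, Ne.symm hj]

end CutFunctional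

lemma card_edgeFinset (n : ℕ) : #(edgeFinset n) = n.choose 2 := by
  have := Sym2.card_subtype_not_diag (α := Fin n)
  rw [Fintype.card_subtype, Fintype.card_fin] at this
  exact this

theorem triangle_intersecting_card_bound
    (n : ℕ) (hn : 3 ≤ n)
    (F : Finset (Finset (Sym2 (Fin n))))
    (hF : F ⊆ (edgeFinset n).powerset)
    (hInt : TriangleIntersecting F) :
    (F.card : ℝ) ≤ (1 / 8) * 2 ^ (n.choose 2) := by
  have hdiag : ∀ e ∈ edgeFinset n, ¬ e.IsDiag := fun e he => (Finset.mem_filter.1 he).2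
  have h := eight_mul_card_le (cutFunctional (V := Fin n)) (edgeFinset n) ?_ ?_ hF ?_
  · rw [card_edgeFinset] at h
    have h' : (8 * #F : ℝ) ≤ 2 ^ n.choose 2 := by exact_mod_cast h
    linarith
  · intro e he h0
    obtain ⟨v, hv⟩ : ∃ v, v ∈ e := ⟨_, e.out_fst_mem⟩
    have := (cutFunctional_single (hdiag e he) v).2 hv
    simp [h0] at this
  · intro e he e' he' h
    ext v
    rw [← cutFunctional_single (hdiag e he), ← cutFunctional_single (hdiag e' he'), h]
  · intro A hA B hB x
    obtain ⟨T, ⟨u, v, w, -, -, -, rfl⟩, hT⟩ := hInt A hA B hB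
    by_contra! h
    have huv := h _ (hT (by simp : s(u, v) ∈ _))
    have huw := h _ (hT (by simp : s(u, w) ∈ _))
    have hvw := h _ (hT (by simp : s(v, w) ∈ _))
    simp only [cutFunctional_mk] at huv huw hvw
    revert huv huw hvw
    generalize x u = p
    generalize x v = q
    generalize x w = r
    revert p q r
    decide
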